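/- Suppose that every tight frame of vectors in the unit ball of a finite-dimensional Hilbert space with frame bound at least 1 can be partitioned into frames each with lower frame bound A and upper frame bound B. Then every frame (f_j)_{j∈J} of a finite-dimensional Hilbert space H with ‖f_j‖≤1 for all j, upper frame bound B₀, and lower frame bound A₀ ≥ 1 can be partitioned into a collection of frames of H each with lower frame bound A and upper frame bound B·B₀/A₀. -/

import Mathlib

open scoped InnerProductSpace

theorem aux_sqrt {H : Type*} [NormedAddCommGroup H] [InnerProductSpace ℂ H]
    [FiniteDimensional ℂ H] {J : Type} (f : J → H)
    (hs : ∀ x : H, Summable fun j => ‖⟪x, f j⟫_ℂ‖ ^ 2) :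
    ∃ S : H →L[ℂ] H, ∀ x : H, ‖S x‖ ^ 2 = ∑' j, ‖⟪x, f j⟫_ℂ‖ ^ 2 := by
  have : CompleteSpace H := FiniteDimensional.complete ℂ H
  have hn : Summable fun j => ‖f j‖ ^ 2 := by
    have h := summable_sum (s := Finset.univ)
      (fun i _ => hs ((stdOrthonormalBasis ℂ H) i))
    refine h.congr fun j => ?_
    exact (stdOrthonormalBasis ℂ H).sum_sq_norm_inner_right (f j)
  have hop : Summable fun j => InnerProductSpace.rankOne ℂ (f j) (f j) := by
    refine Summable.of_norm (hn.congr fun j => ?_)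
    rw [InnerProductSpace.norm_rankOne, sq]
  set T : H →L[ℂ] H := ∑' j, InnerProductSpace.rankOne ℂ (f j) (f j) with hT
  have key : ∀ x, ⟪x, T x⟫_ℂ = ((∑' j, ‖⟪x, f j⟫_ℂ‖ ^ 2 : ℝ) : ℂ) := by
    intro x
    have h1 : HasSum (fun j => InnerProductSpace.rankOne ℂ (f j) (f j) x) (T x) :=
      hop.hasSum.mapL (ContinuousLinearMap.apply ℂ H x)
    have h2 := h1.mapL (innerSL ℂ x)
    have h3 : HasSum (fun j => ((‖⟪x, f j⟫_ℂ‖ ^ 2 : ℝ) : ℂ)) _ :=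
      Complex.hasSum_ofReal.2 (hs x).hasSum
    refine HasSum.unique (f := fun j => ((‖⟪x, f j⟫_ℂ‖ ^ 2 : ℝ) : ℂ)) ?_ h3
    have heq : (fun j => ((‖⟪x, f j⟫_ℂ‖ ^ 2 : ℝ) : ℂ)) =
        fun j => innerSL ℂ x (InnerProductSpace.rankOne ℂ (f j) (f j) x) := by
      funext j
      simp only [innerSL_apply_apply, InnerProductSpace.rankOne_apply, inner_smul_right]
      rw [← inner_conj_symm (f j) x, mul_comm, Complex.mul_conj, Complex.normSq_eq_norm_sq]
    rw [heq]
    exact h2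
  have hpos : (0 : H →L[ℂ] H) ≤ T := by
    rw [hT]
    exact tsum_nonneg fun j => 
      (ContinuousLinearMap.nonneg_iff_isPositive _).2 (InnerProductSpace.isPositive_rankOne_self _)
  refine ⟨CFC.sqrt T, fun x => ?_⟩
  have hsa : IsSelfAdjoint (CFC.sqrt T) := (CFC.sqrt_nonneg T).isSelfAdjoint
  have h := key x
  rw [← CFC.sqrt_mul_sqrt_self T hpos, mul_apply_eq_comp,
    ← ContinuousLinearMap.adjoint_inner_left, hsa.adjoint_eq,
    inner_self_eq_norm_sq_to_K] at h
  refine Complex.ofReal_injective (Eq.trans ?_ h)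
  rw [Complex.ofReal_pow]
  rfl

theorem stmt12 {H : Type*} [NormedAddCommGroup H] [InnerProductSpace ℂ H]
    [FiniteDimensional ℂ H] (A B : ℝ) (hA : 0 < A) (hB : 0 < B)
    (hyp : ∀ (J' : Type) (g : J' → H) (C : ℝ), 1 ≤ C → (∀ j, ‖g j‖ ≤ 1) →
      (∀ x : H, ∑' j, ‖⟪x, g j⟫_ℂ‖ ^ 2 = C * ‖x‖ ^ 2) →
      ∃ (M : ℕ) (c : J' → Fin M), ∀ m : Fin M, ∀ x : H,
        A * ‖x‖ ^ 2 ≤ ∑' j : {j : J' // c j = m}, ‖⟪x, g (j : J')⟫_ℂ‖ ^ 2 ∧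
        ∑' j : {j : J' // c j = m}, ‖⟪x, g (j : J')⟫_ℂ‖ ^ 2 ≤ B * ‖x‖ ^ 2)
    (J : Type) (f : J → H) (A₀ B₀ : ℝ) (hA₀ : 1 ≤ A₀) (hf : ∀ j, ‖f j‖ ≤ 1)
    (hframe : ∀ x : H,
      A₀ * ‖x‖ ^ 2 ≤ ∑' j, ‖⟪x, f j⟫_ℂ‖ ^ 2 ∧
      ∑' j, ‖⟪x, f j⟫_ℂ‖ ^ 2 ≤ B₀ * ‖x‖ ^ 2) :
    ∃ (M : ℕ) (c : J → Fin M), ∀ m : Fin M, ∀ x : H,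
      A * ‖x‖ ^ 2 ≤ ∑' j : {j : J // c j = m}, ‖⟪x, f (j : J)⟫_ℂ‖ ^ 2 ∧
      ∑' j : {j : J // c j = m}, ‖⟪x, f (j : J)⟫_ℂ‖ ^ 2 ≤ B * B₀ / A₀ * ‖x‖ ^ 2 := by
  have : CompleteSpace H := FiniteDimensional.complete ℂ H
  have hA0 : 0 < A₀ := by linarith
  have hs : ∀ x : H, Summable fun j => ‖⟪x, f j⟫_ℂ‖ ^ 2 := by
    intro x
    by_cases hx : x = 0
    · simp [hx, summable_zero]
    · by_contra hns
      have h := (hframe x).1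
      rw [tsum_eq_zero_of_not_summable hns] at h
      have : 0 < ‖x‖ := norm_pos_iff.2 hx
      have : 0 < A₀ * ‖x‖ ^ 2 := by positivity
      linarith
  obtain ⟨S, hS⟩ := aux_sqrt f hs
  have hlow : ∀ x, A₀ * ‖x‖ ^ 2 ≤ ‖S x‖ ^ 2 := fun x => by rw [hS]; exact (hframe x).1
  have hup : ∀ x, ‖S x‖ ^ 2 ≤ B₀ * ‖x‖ ^ 2 := fun x => by rw [hS]; exact (hframe x).2
  have hinj : Function.Injective (S : H →ₗ[ℂ] H) := by
    rw [injective_iff_map_eq_zero]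
    intro x hx
    have h := hlow x
    have hx' : S x = 0 := hx
    rw [hx', norm_zero] at h
    by_contra hne
    have : 0 < ‖x‖ := norm_pos_iff.2 hne
    have : 0 < A₀ * ‖x‖ ^ 2 := by positivity
    linarith
  let e := LinearEquiv.ofInjectiveEndo (S : H →ₗ[ℂ] H) hinj
  let R : H →L[ℂ] H := LinearMap.toContinuousLinearMap (e.symm : H →ₗ[ℂ] H)
  have hSR : ∀ y, S (R y) = y := fun y => e.apply_symm_apply y
  have hRS : ∀ y, R (S y) = y := fun y => e.symm_apply_apply y
  let g : J → H := fun j => ((Real.sqrt A₀ : ℝ) : ℂ) • (ContinuousLinearMap.adjoint R (f j))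
  have hg : ∀ y j, ‖⟪y, g j⟫_ℂ‖ ^ 2 = A₀ * ‖⟪R y, f j⟫_ℂ‖ ^ 2 := by
    intro y j
    simp only [g, inner_smul_right, ContinuousLinearMap.adjoint_inner_right, norm_mul,
      Complex.norm_real, mul_pow, Real.norm_eq_abs, sq_abs, Real.sq_sqrt hA0.le]
  have hg1 : ∀ j, ‖g j‖ ≤ 1 := by
    intro j
    have h1 := hg (g j) j
    have h2 : ‖⟪R (g j), f j⟫_ℂ‖ ≤ ‖R (g j)‖ :=
      (norm_inner_le_norm _ _).trans (mul_le_of_le_one_right (norm_nonneg _) (hf j))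
    have h3 := hlow (R (g j))
    rw [hSR] at h3
    have h4 : ‖⟪R (g j), f j⟫_ℂ‖ ^ 2 ≤ ‖R (g j)‖ ^ 2 := by gcongr
    rw [inner_self_eq_norm_sq_to_K] at h1
    simp only [norm_pow, RCLike.norm_ofReal, abs_norm] at h1
    have h5 : (‖g j‖ ^ 2) ^ 2 ≤ ‖g j‖ ^ 2 := by nlinarith
    by_contra! hlt
    have h6 : 1 < ‖g j‖ ^ 2 := by nlinarith
    nlinarith
  obtain ⟨M, c, hc⟩ := hyp J g A₀ hA₀ hg1 (fun x => by
    simp only [hg, tsum_mul_left]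
    rw [← hS, hSR])
  refine ⟨M, c, fun m x => ?_⟩
  have h := hc m (S x)
  simp only [hg, tsum_mul_left, hRS] at h
  obtain ⟨h1, h2⟩ := h
  constructor
  · have := mul_le_mul_of_nonneg_left (hlow x) hA.le
    refine le_of_mul_le_mul_left ?_ hA0
    linarith
  · have := mul_le_mul_of_nonneg_left (hup x) hB.le
    rw [div_mul_eq_mul_div, le_div_iff₀ hA0]
    linarith
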